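/- arXiv:2605.23889 — 3 statements merged into one kernel-verified Lean document; each statement's English description precedes it below -/
import Mathlib

section
/- Let t ≥ 1 and W be natural numbers with 1 ≤ W < t, and let M ≥ 0. Let s : Fin t → ℝ be attention scores with |s i| ≤ M for all i, and define the softmax weights α i = exp(s i) / ∑_{j} exp(s j). Then for any subset R ⊆ Fin t with |R| ≤ W, the total weight on R satisfies ∑_{i ∈ R} α i ≤ 1 / (1 + ((t - W)/W) · e^{-2M}). -/
/-- Geometric attention dilution bound: with scores bounded by `M`, the total softmax
mass on any subset `R` of size at most `W` is at most `1 / (1 + ((t-W)/W) e^{-2M})`. -/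
theorem softmax_dilution_bound (t W : ℕ) (hW1 : 1 ≤ W) (hWt : W < t)
    (M : ℝ) (hM : 0 ≤ M) (s : Fin t → ℝ) (hs : ∀ i, |s i| ≤ M)
    (α : Fin t → ℝ) (hα : ∀ i, α i = Real.exp (s i) / ∑ j, Real.exp (s j))
    (R : Finset (Fin t)) (hR : R.card ≤ W) :
    ∑ i ∈ R, α i ≤ 1 / (1 + (((t : ℝ) - (W : ℝ)) / (W : ℝ)) * Real.exp (-2 * M)) := by
  have hW : (0 : ℝ) < W := by exact_mod_cast hW1
  have htW : (0 : ℝ) < t - W := sub_pos.mpr (by exact_mod_cast hWt)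
  have hRW : (R.card : ℝ) ≤ W := by exact_mod_cast hR
  have hcompl : (R.card : ℝ) + (Rᶜ.card : ℝ) = t := by
    exact_mod_cast (Finset.card_add_card_compl R).trans (Fintype.card_fin t)
  have hin : ∑ i ∈ R, Real.exp (s i) ≤ W * Real.exp M :=
    calc ∑ i ∈ R, Real.exp (s i) ≤ R.card * Real.exp M := by
          rw [← nsmul_eq_mul]
          exact Finset.sum_le_card_nsmul R _ _ fun i _ =>
            Real.exp_le_exp.mpr (abs_le.mp (hs i)).2
      _ ≤ W * Real.exp M := by gcongr
  have hout : (t - W) * Real.exp (-M) ≤ ∑ i ∈ Rᶜ, Real.exp (s i) :=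
    calc ((t : ℝ) - W) * Real.exp (-M) ≤ Rᶜ.card * Real.exp (-M) := by
          gcongr
          linarith
      _ ≤ ∑ i ∈ Rᶜ, Real.exp (s i) := by
          rw [← nsmul_eq_mul]
          exact Finset.card_nsmul_le_sum Rᶜ _ _ fun i _ =>
            Real.exp_le_exp.mpr (abs_le.mp (hs i)).1
  have hin_nonneg : 0 ≤ ∑ i ∈ R, Real.exp (s i) :=
    Finset.sum_nonneg fun i _ => (Real.exp_pos (s i)).le
  have hout_pos : 0 < ∑ i ∈ Rᶜ, Real.exp (s i) :=
    (mul_pos htW (Real.exp_pos _)).trans_le hout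
  have hratio : (∑ i ∈ R, Real.exp (s i)) * ((t - W) / W * Real.exp (-2 * M)) ≤
      ∑ i ∈ Rᶜ, Real.exp (s i) :=
    calc (∑ i ∈ R, Real.exp (s i)) * ((t - W) / W * Real.exp (-2 * M))
        ≤ W * Real.exp M * ((t - W) / W * Real.exp (-2 * M)) := by gcongr
      _ = (t - W) * (Real.exp M * Real.exp (-2 * M)) := by field_simp
      _ = (t - W) * Real.exp (-M) := by
          rw [← Real.exp_add]
          ring_nf
      _ ≤ ∑ i ∈ Rᶜ, Real.exp (s i) := hout
  simp_rw [hα]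
  rw [← Finset.sum_div, ← Finset.sum_add_sum_compl R, div_le_div_iff₀ (by positivity)
    (by positivity)]
  linarith
end

section
/- Let t ≥ 1 and W be natural numbers with 1 ≤ W < t, let M ≥ 0, let s : Fin t → ℝ satisfy |s i| ≤ M for all i, and let α i = exp(s i) / ∑_{j} exp(s j). If t > W · (1 + e^{2M}), then for any subset R ⊆ Fin t with |R| ≤ W, we have ∑_{i ∈ R} α i < 1/2; equivalently, more than half of the total softmax mass falls outside R. -/
/-- If `t > W (1 + e^{2M})`, more than half of the softmax mass falls outside any
subset `R` of size at most `W`: the mass on `R` is strictly less than `1/2`. -/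
theorem softmax_majority_outside (t W : ℕ) (hW1 : 1 ≤ W) (hWt : W < t)
    (M : ℝ) (hM : 0 ≤ M) (s : Fin t → ℝ) (hs : ∀ i, |s i| ≤ M)
    (α : Fin t → ℝ) (hα : ∀ i, α i = Real.exp (s i) / ∑ j, Real.exp (s j))
    (ht : (t : ℝ) > (W : ℝ) * (1 + Real.exp (2 * M)))
    (R : Finset (Fin t)) (hR : R.card ≤ W) :
    ∑ i ∈ R, α i < 1 / 2 := by
  have hRW : (R.card : ℝ) ≤ W := by exact_mod_cast hR
  have inside : ∑ i ∈ R, Real.exp (s i) ≤ W * Real.exp M := by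
    calc ∑ i ∈ R, Real.exp (s i) ≤ R.card • Real.exp M :=
          Finset.sum_le_card_nsmul _ _ _ fun i _ => Real.exp_le_exp.2 (abs_le.1 (hs i)).2
      _ = R.card * Real.exp M := nsmul_eq_mul _ _
      _ ≤ W * Real.exp M := by gcongr
  have card_compl : (Rᶜ.card : ℝ) = t - R.card := by
    rw [Finset.card_compl, Fintype.card_fin, Nat.cast_sub (hR.trans hWt.le)]
  have outside : (t - W) * Real.exp (-M) ≤ ∑ i ∈ Rᶜ, Real.exp (s i) := by
    calc (t - W) * Real.exp (-M) ≤ Rᶜ.card * Real.exp (-M) := by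
          rw [card_compl]; gcongr
      _ = Rᶜ.card • Real.exp (-M) := (nsmul_eq_mul _ _).symm
      _ ≤ ∑ i ∈ Rᶜ, Real.exp (s i) :=
          Finset.card_nsmul_le_sum _ _ _ fun i _ => Real.exp_le_exp.2 (abs_le.1 (hs i)).1
  have gap : W * Real.exp M < (t - W) * Real.exp (-M) := by
    calc W * Real.exp M = W * Real.exp (2 * M) * Real.exp (-M) := by
          rw [mul_assoc, ← Real.exp_add]; ring_nf
      _ < (t - W) * Real.exp (-M) := by gcongr; linarith
  have total := Finset.sum_add_sum_compl R fun i => Real.exp (s i)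
  have nonneg : 0 ≤ ∑ i ∈ R, Real.exp (s i) := by positivity
  simp only [hα]
  rw [← Finset.sum_div, div_lt_iff₀ (by linarith)]
  linarith
end

section
/- Let t ≥ 1 and W be natural numbers with 1 ≤ W < t, let M ≥ 0, and fix a subset R ⊆ Fin t with |R| = W. Among all score assignments s : Fin t → ℝ with |s i| ≤ M for all i, the total softmax weight ∑_{i ∈ R} exp(s i) / ∑_{j} exp(s j) is maximized by the assignment s i = M for i ∈ R and s i = -M for i ∉ R, and the maximal value equals W·e^{M} / (W·e^{M} + (t - W)·e^{-M}). -/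
/-- The softmax mass of `R` increases when scores are raised on `R` and lowered off `R`. -/
lemma softmax_mass_mono {ι : Type*} [Fintype ι] [DecidableEq ι] (R : Finset ι) {s u : ι → ℝ}
    (hin : ∀ i ∈ R, s i ≤ u i) (hout : ∀ i ∉ R, u i ≤ s i) :
    ∑ i ∈ R, Real.exp (s i) / ∑ j, Real.exp (s j) ≤
      ∑ i ∈ R, Real.exp (u i) / ∑ j, Real.exp (u j) := by
  rcases R.eq_empty_or_nonempty with rfl | hR
  · simp
  have hA : ∑ i ∈ R, Real.exp (s i) ≤ ∑ i ∈ R, Real.exp (u i) :=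
    Finset.sum_le_sum fun i hi => Real.exp_le_exp.2 (hin i hi)
  have hB : ∑ i ∈ Rᶜ, Real.exp (u i) ≤ ∑ i ∈ Rᶜ, Real.exp (s i) :=
    Finset.sum_le_sum fun i hi => Real.exp_le_exp.2 (hout i (Finset.mem_compl.1 hi))
  have hpos (v : ι → ℝ) : 0 < ∑ i ∈ R, Real.exp (v i) :=
    Finset.sum_pos (fun i _ => Real.exp_pos _) hR
  have hnonneg (v : ι → ℝ) : 0 ≤ ∑ i ∈ Rᶜ, Real.exp (v i) :=
    Finset.sum_nonneg fun i _ => (Real.exp_pos _).le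
  rw [← Finset.sum_div, ← Finset.sum_div, ← Finset.sum_add_sum_compl R,
    ← Finset.sum_add_sum_compl R fun j => Real.exp (u j),
    div_le_div_iff₀ (add_pos_of_pos_of_nonneg (hpos s) (hnonneg s))
      (add_pos_of_pos_of_nonneg (hpos u) (hnonneg u))]
  linarith [mul_le_mul hA hB (hnonneg u) (hpos u).le]

/-- Among all score assignments bounded by `M`, the softmax mass on a fixed set `R`
of cardinality `W` is maximized by assigning `M` on `R` and `-M` off `R`, and the
maximal value equals `W e^M / (W e^M + (t - W) e^{-M})`. -/
theorem softmax_mass_maximizer (t W : ℕ) (hW1 : 1 ≤ W) (hWt : W < t)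
    (M : ℝ) (hM : 0 ≤ M) (R : Finset (Fin t)) (hR : R.card = W) :
    (∀ s : Fin t → ℝ, (∀ i, |s i| ≤ M) →
      (∑ i ∈ R, Real.exp (s i) / ∑ j, Real.exp (s j)) ≤
      ∑ i ∈ R, Real.exp (if i ∈ R then M else (-M)) /
        ∑ j, Real.exp (if j ∈ R then M else (-M))) ∧
    (∑ i ∈ R, Real.exp (if i ∈ R then M else (-M)) /
        ∑ j, Real.exp (if j ∈ R then M else (-M))) =
      (W : ℝ) * Real.exp M / ((W : ℝ) * Real.exp M + ((t : ℝ) - (W : ℝ)) * Real.exp (-M)) := by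
  refine ⟨fun s hs => softmax_mass_mono R (fun i hi => ?_) (fun i hi => ?_), ?_⟩
  · rw [if_pos hi]
    exact (abs_le.1 (hs i)).2
  · rw [if_neg hi]
    exact (abs_le.1 (hs i)).1
  · have hin : ∑ i ∈ R, Real.exp (if i ∈ R then M else -M) = W * Real.exp M := by
      rw [Finset.sum_congr rfl fun i hi => by rw [if_pos hi], Finset.sum_const, hR, nsmul_eq_mul]
    have hout : ∑ i ∈ Rᶜ, Real.exp (if i ∈ R then M else -M) =
        ((t : ℝ) - W) * Real.exp (-M) := by
      rw [Finset.sum_congr rfl fun i hi => by rw [if_neg (Finset.mem_compl.1 hi)],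
        Finset.sum_const, Finset.card_compl, hR, Fintype.card_fin, nsmul_eq_mul,
        Nat.cast_sub hWt.le]
    rw [← Finset.sum_div, ← Finset.sum_add_sum_compl R, hin, hout]
end
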